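/- arXiv:1612.00731 — 2 statements merged into one kernel-verified Lean document; each statement's English description precedes it below -/
import Mathlib

section
/- Let G = (V,E) be a finite connected simple graph with m edges, and let h(i,j) denote the expected hitting time of vertex j by a simple random walk started at i, and R(i,j) the effective resistance with unit edge resistances. Then the commute time satisfies h(i,j) + h(j,i) = 2m·R(i,j) for all i, j ∈ V. -/
/-- `θ` is a unit flow from `u` to `v` on the graph `G`. -/
def IsUnitFlow {V : Type*} [Fintype V] (G : SimpleGraph V) (u v : V) (θ : V → V → ℝ) : Prop :=
  (∀ x y, θ x y = -θ y x) ∧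
  (∀ x y, ¬ G.Adj x y → θ x y = 0) ∧
  (∀ x, x ≠ u → x ≠ v → ∑ y, θ x y = 0) ∧
  (∑ y, θ u y = 1)

/-- The energy dissipated by a flow with unit resistances. -/
noncomputable def flowEnergy {V : Type*} [Fintype V] (θ : V → V → ℝ) : ℝ :=
  (1 / 2) * ∑ x, ∑ y, (θ x y) ^ 2

/-- The effective resistance between `u` and `v` with unit resistances. -/
noncomputable def effRes {V : Type*} [Fintype V] (G : SimpleGraph V) (u v : V) : ℝ :=
  sInf {E | ∃ θ, IsUnitFlow G u v θ ∧ flowEnergy θ = E}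

/-- `H i j` is the expected hitting time of `j` by a simple random walk started at `i`:
`H j j = 0` and, for `i ≠ j`, `H i j = 1 + (1/deg i) ∑_{y ~ i} H y j`. -/
def IsHittingTime {V : Type*} [Fintype V] (G : SimpleGraph V) [DecidableRel G.Adj]
    (H : V → V → ℝ) : Prop :=
  (∀ j, H j j = 0) ∧
  ∀ i j, i ≠ j → H i j = 1 + (∑ y ∈ G.neighborFinset i, H y j) / (G.degree i : ℝ)

open Finset in
theorem ctf_antisymm_sum {V : Type*} [Fintype V] (θ : V → V → ℝ)
    (h : ∀ x y, θ x y = -θ y x) : ∑ x, ∑ y, θ x y = 0 := by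
  have h1 : ∑ x, ∑ y, θ x y = -∑ x, ∑ y, θ x y := by
    conv_lhs => rw [Finset.sum_comm]
    rw [← Finset.sum_neg_distrib]
    refine Finset.sum_congr rfl fun x _ => ?_
    rw [← Finset.sum_neg_distrib]
    exact Finset.sum_congr rfl fun y _ => h y x
  linarith

theorem ctf_div {V : Type*} [Fintype V] [DecidableEq V] (f : V → ℝ) (j : V) (c : V → ℝ)
    (h0 : ∑ x, f x = 0) (h : ∀ x, x ≠ j → f x = c x) :
    ∀ x, f x = c x - if x = j then ∑ y, c y else 0 := by
  intro x
  by_cases hx : x = j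
  · subst hx
    rw [← Finset.add_sum_erase _ _ (Finset.mem_univ x)] at h0
    rw [if_pos rfl, ← Finset.add_sum_erase _ c (Finset.mem_univ x)]
    have : ∑ y ∈ Finset.univ.erase x, f y = ∑ y ∈ Finset.univ.erase x, c y :=
      Finset.sum_congr rfl fun y hy => h y (Finset.ne_of_mem_erase hy)
    linarith
  · simp [hx, h x hx]

/-- Pairing of a unit flow with a potential difference. -/
theorem ctf_pair {V : Type*} [Fintype V] [DecidableEq V] (G : SimpleGraph V) (i j : V)
    (hij : i ≠ j) (θ : V → V → ℝ) (hθ : IsUnitFlow G i j θ) (φ : V → ℝ) :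
    ∑ x, ∑ y, θ x y * (φ x - φ y) = 2 * (φ i - φ j) := by
  obtain ⟨ha, hadj, hz, h1⟩ := hθ
  have hd : ∀ x, ∑ y, θ x y = (if x = i then 1 else 0) - if x = j then 1 else 0 := by
    have := ctf_div (fun x => ∑ y, θ x y) j (fun x => if x = i then 1 else 0)
      (ctf_antisymm_sum θ ha) (by
        intro x hx
        by_cases hxi : x = i
        · subst hxi; simpa using h1
        · simpa [hxi] using hz x hxi hx)
    simpa using this
  have hA : ∑ x, ∑ y, θ x y * φ x = φ i - φ j := by
    simp_rw [← Finset.sum_mul, hd, sub_mul, Finset.sum_sub_distrib]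
    simp
  have hB : ∑ x, ∑ y, θ x y * φ y = -(φ i - φ j) := by
    rw [Finset.sum_comm, ← hA, ← Finset.sum_neg_distrib]
    refine Finset.sum_congr rfl fun x _ => ?_
    rw [← Finset.sum_neg_distrib]
    refine Finset.sum_congr rfl fun y _ => ?_
    rw [ha y x]; ring
  simp_rw [mul_sub, Finset.sum_sub_distrib]
  rw [hA, hB]; ring

theorem ctf_lap {V : Type*} [Fintype V] [DecidableEq V] (G : SimpleGraph V)
    [DecidableRel G.Adj] (hdeg : ∀ x, (G.degree x : ℝ) ≠ 0) (H : V → V → ℝ)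
    (hH : IsHittingTime G H) (j x : V) :
    ∑ y, (if G.Adj x y then H x j - H y j else 0) =
      (G.degree x : ℝ) - if x = j then 2 * (G.edgeFinset.card : ℝ) else 0 := by
  have hs : ∑ y, (G.degree y : ℝ) = 2 * (G.edgeFinset.card : ℝ) := by
    exact_mod_cast G.sum_degrees_eq_twice_card_edges
  rw [← hs]
  refine ctf_div (fun x => ∑ y, (if G.Adj x y then H x j - H y j else 0)) j
    (fun x => (G.degree x : ℝ)) ?_ ?_ x
  · apply ctf_antisymm_sum (fun x y => (if G.Adj x y then H x j - H y j else 0))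
    intro x y
    by_cases h : G.Adj x y
    · simp [h, h.symm]
    · simp [h, G.adj_comm y x]
  · intro x hx
    have h2 := hH.2 x j hx
    rw [← Finset.sum_filter, ← SimpleGraph.neighborFinset_eq_filter, Finset.sum_sub_distrib,
      Finset.sum_const, SimpleGraph.card_neighborFinset_eq_degree, nsmul_eq_mul]
    have := hdeg x
    field_simp at h2
    linarith

/-- **The commute time formula.** For a finite connected simple graph `G` with `m` edges,
`h(i,j) + h(j,i) = 2m·R(i,j)` for all vertices `i, j`. -/
theorem commute_time_formula {V : Type*} [Fintype V] [DecidableEq V] (G : SimpleGraph V)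
    [DecidableRel G.Adj] (hG : G.Connected) (H : V → V → ℝ) (hH : IsHittingTime G H)
    (i j : V) :
    H i j + H j i = 2 * (G.edgeFinset.card : ℝ) * effRes G i j := by
  by_cases hij : i = j
  · subst hij
    have he : {E | ∃ θ, IsUnitFlow G i i θ ∧ flowEnergy θ = E} = ∅ := by
      ext E
      simp only [Set.mem_ofPred_eq, Set.mem_empty_iff_false, iff_false]
      rintro ⟨θ, ⟨ha, -, hz, h1⟩, -⟩
      have h0 := ctf_antisymm_sum θ ha
      rw [Finset.sum_eq_single i (fun x _ hx => hz x hx hx) (by simp)] at h0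
      linarith
    simp [effRes, he, hH.1]
  have : Nontrivial V := ⟨i, j, hij⟩
  have hpos : ∀ x, 0 < G.degree x := fun x => hG.preconnected.degree_pos_of_nontrivial x
  have hdeg : ∀ x, (G.degree x : ℝ) ≠ 0 := fun x => by
    exact_mod_cast (hpos x).ne'
  have hD : (2 * (G.edgeFinset.card : ℝ)) ≠ 0 := by
    have h := G.sum_degrees_eq_twice_card_edges
    have h2 : G.degree i ≤ ∑ x, G.degree x :=
      Finset.single_le_sum (f := fun x => G.degree x) (fun _ _ => Nat.zero_le _) (Finset.mem_univ i)
    have h3 := hpos i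
    have : 2 * G.edgeFinset.card ≠ 0 := by omega
    exact_mod_cast this
  have hlap := ctf_lap G hdeg H hH
  generalize 2 * (G.edgeFinset.card : ℝ) = D at hD hlap ⊢
  set φ : V → ℝ := fun x => (H x j - H x i) / D with hφ
  set ψ : V → V → ℝ := fun x y => if G.Adj x y then φ x - φ y else 0 with hψ
  have hdiv : ∀ x, ∑ y, ψ x y = (if x = i then 1 else 0) - if x = j then 1 else 0 := by
    intro x
    have h1 : ∑ y, ψ x y = ((∑ y, (if G.Adj x y then H x j - H y j else 0)) -
        ∑ y, (if G.Adj x y then H x i - H y i else 0)) / D := by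
      rw [← Finset.sum_sub_distrib, Finset.sum_div]
      refine Finset.sum_congr rfl fun y _ => ?_
      simp only [hψ, hφ]
      split_ifs <;> ring
    rw [h1, hlap, hlap]
    split_ifs <;> field_simp <;> ring
  have hψf : IsUnitFlow G i j ψ := by
    refine ⟨?_, ?_, ?_, ?_⟩
    · intro x y
      by_cases h : G.Adj x y
      · simp [hψ, h, h.symm]
      · simp [hψ, h, G.adj_comm y x]
    · intro x y h; simp [hψ, h]
    · intro x hi hj; simp [hdiv, hi, hj]
    · simp [hdiv, hij]
  have hpair : ∀ θ, IsUnitFlow G i j θ → ∑ x, ∑ y, θ x y * ψ x y = 2 * (φ i - φ j) := by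
    intro θ hθ
    rw [← ctf_pair G i j hij θ hθ φ]
    refine Finset.sum_congr rfl fun x _ => Finset.sum_congr rfl fun y _ => ?_
    by_cases h : G.Adj x y
    · simp [hψ, h]
    · simp [hθ.2.1 x y h]
  have hE : flowEnergy ψ = φ i - φ j := by
    have := hpair ψ hψf
    simp_rw [← sq] at this
    rw [flowEnergy, this]; ring
  have hmin : IsLeast {E | ∃ θ, IsUnitFlow G i j θ ∧ flowEnergy θ = E} (φ i - φ j) := by
    refine ⟨⟨ψ, hψf, hE⟩, ?_⟩
    rintro E ⟨θ, hθ, rfl⟩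
    have h0 : 0 ≤ ∑ x, ∑ y, (θ x y - ψ x y) ^ 2 :=
      Finset.sum_nonneg fun x _ => Finset.sum_nonneg fun y _ => sq_nonneg _
    have h1 : ∑ x, ∑ y, (θ x y - ψ x y) ^ 2 = ∑ x, ∑ y, (θ x y) ^ 2
        - 2 * ∑ x, ∑ y, θ x y * ψ x y + ∑ x, ∑ y, (ψ x y) ^ 2 := by
      simp_rw [Finset.mul_sum, ← Finset.sum_sub_distrib, ← Finset.sum_add_distrib]
      refine Finset.sum_congr rfl fun x _ => Finset.sum_congr rfl fun y _ => ?_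
      ring
    rw [hpair θ hθ] at h1
    unfold flowEnergy at hE ⊢
    linarith
  rw [effRes, hmin.csInf_eq]
  simp only [hφ, hH.1]
  field_simp
  ring
end

section
/- Let X_n ~ Bin(n, p(n)) with np → ∞ as n → ∞, and let a > 0 be real and b ≥ 1 an integer. Then 1/(a+np)^b ≤ E[1/(a+X_n)^b] ≤ 1/(a+np)^b + O(1/(np)^{b+1}), i.e., there exist constants C and N such that for all n ≥ N, E[1/(a+X_n)^b] ≤ 1/(a+np)^b + C/(np)^{b+1}. -/
open Filter

/-- The binomial weights. -/
noncomputable def binW (n : ℕ) (p : ℝ) (k : ℕ) : ℝ :=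
  (n.choose k : ℝ) * p ^ k * (1 - p) ^ (n - k)

lemma binW_eval (n : ℕ) (p : ℝ) (k : ℕ) :
    (bernsteinPolynomial ℝ n k).eval p = binW n p k := by
  simp [bernsteinPolynomial, binW]

lemma binW_nonneg (n : ℕ) {p : ℝ} (h0 : 0 < p) (h1 : p < 1) (k : ℕ) : 0 ≤ binW n p k := by
  have : 0 ≤ 1 - p := by linarith
  unfold binW
  positivity

lemma binW_sum (n : ℕ) (p : ℝ) : ∑ k ∈ Finset.range (n + 1), binW n p k = 1 := by
  have h := congrArg (Polynomial.eval p) (bernsteinPolynomial.sum ℝ n)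
  simpa [Polynomial.eval_finsetSum, binW_eval] using h

lemma binW_mean (n : ℕ) (p : ℝ) :
    ∑ k ∈ Finset.range (n + 1), binW n p k * ((k : ℝ) - n * p) = 0 := by
  have h := congrArg (Polynomial.eval p) (bernsteinPolynomial.sum_smul ℝ n)
  simp [Polynomial.eval_finsetSum, binW_eval] at h
  have h2 := binW_sum n p
  simp only [mul_sub, Finset.sum_sub_distrib, ← Finset.sum_mul, h2]
  rw [Finset.sum_congr rfl (fun k _ => mul_comm _ _), h]
  ring

lemma binW_var (n : ℕ) (p : ℝ) :
    ∑ k ∈ Finset.range (n + 1), binW n p k * ((k : ℝ) - n * p) ^ 2 = n * p * (1 - p) := by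
  have h := congrArg (Polynomial.eval p) (bernsteinPolynomial.variance ℝ n)
  simp [Polynomial.eval_finsetSum, binW_eval] at h
  rw [← h]
  refine Finset.sum_congr rfl fun k _ => ?_
  ring

lemma binW_step (n : ℕ) {p : ℝ} (h0 : 0 < p) (k : ℕ) :
    binW n p k / ((k : ℝ) + 1) = binW (n + 1) p (k + 1) / (((n : ℝ) + 1) * p) := by
  have h : ((n : ℝ) + 1) * n.choose k = (n + 1).choose (k + 1) * ((k : ℝ) + 1) := by
    exact_mod_cast Nat.add_one_mul_choose_eq n k
  unfold binW
  rw [Nat.add_sub_add_right]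
  have hk : (0 : ℝ) < (k : ℝ) + 1 := by positivity
  have hn : (0 : ℝ) < (n : ℝ) + 1 := by positivity
  rw [div_eq_div_iff hk.ne' (by positivity), pow_succ]
  linear_combination (p ^ k * p * (1 - p) ^ (n - k)) * h

lemma binW_one (n : ℕ) {p : ℝ} (h0 : 0 < p) (h1 : p < 1) (h : ℝ → ℝ) (hh : ∀ k : ℕ, 0 ≤ h k) :
    ∑ k ∈ Finset.range (n + 1), binW n p k * (h ((k : ℝ) + 1) / ((k : ℝ) + 1))
      ≤ (1 / (((n : ℝ) + 1) * p)) * ∑ k ∈ Finset.range (n + 2), binW (n + 1) p k * h k := by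
  rw [Finset.sum_range_succ' _ (n + 1), mul_add, Finset.mul_sum]
  have hz : 0 ≤ 1 / (((n : ℝ) + 1) * p) * (binW (n + 1) p 0 * h ((0 : ℕ) : ℝ)) :=
    mul_nonneg (by positivity) (mul_nonneg (binW_nonneg _ h0 h1 _) (hh 0))
  refine le_trans (le_of_eq ?_) (le_add_of_nonneg_right hz)
  refine Finset.sum_congr rfl fun k _ => ?_
  have := binW_step n h0 k
  push_cast
  calc _ = binW n p k / ((k : ℝ) + 1) * h ((k : ℝ) + 1) := by ring
    _ = _ := by rw [this]; ring

lemma binW_multi {p : ℝ} (h0 : 0 < p) (h1 : p < 1) (b : ℕ) :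
    ∀ (n : ℕ) (_ : 0 < n) (g : ℝ → ℝ) (_ : ∀ x, 0 ≤ g x),
    ∑ k ∈ Finset.range (n + 1), binW n p k * (g k / ∏ j ∈ Finset.range b, ((k : ℝ) + 1 + j))
      ≤ (1 / ((n : ℝ) * p) ^ b) *
        ∑ k ∈ Finset.range (n + b + 1), binW (n + b) p k * g ((k : ℝ) - b) := by
  induction b with
  | zero => intro n _ g _; simp
  | succ b ih =>
    intro n hn g hg
    have hn' : (0 : ℝ) < n := by exact_mod_cast hn
    have e1 := binW_one n h0 h1
      (fun y => g (y - 1) / ∏ j ∈ Finset.range b, (y + 1 + j))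
      (fun k => div_nonneg (hg _) (Finset.prod_nonneg fun j _ => by positivity))
    have e2 := ih (n + 1) (by omega) (fun y => g (y - 1)) (fun x => hg _)
    have hS : 0 ≤ ∑ k ∈ Finset.range (n + (b + 1) + 1),
        binW (n + (b + 1)) p k * g ((k : ℝ) - ((b + 1 : ℕ) : ℝ)) :=
      Finset.sum_nonneg fun k _ => mul_nonneg (binW_nonneg _ h0 h1 _) (hg _)
    have e3 : ∑ k ∈ Finset.range (n + 1 + b + 1),
        binW (n + 1 + b) p k * g ((k : ℝ) - b - 1) =
        ∑ k ∈ Finset.range (n + (b + 1) + 1),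
        binW (n + (b + 1)) p k * g ((k : ℝ) - ((b + 1 : ℕ) : ℝ)) := by
      rw [show n + 1 + b = n + (b + 1) by omega]
      refine Finset.sum_congr rfl fun k _ => ?_
      push_cast
      rw [sub_sub]
    rw [e3] at e2
    have e4 : (1 / (((n : ℝ) + 1) * p)) * (1 / (((n + 1 : ℕ) : ℝ) * p) ^ b)
        ≤ 1 / ((n : ℝ) * p) ^ (b + 1) := by
      rw [Nat.cast_add_one, one_div_mul_one_div, ← pow_succ']
      apply one_div_le_one_div_of_le (by positivity)
      gcongr
      linarith
    calc _ = ∑ k ∈ Finset.range (n + 1), binW n p k *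
          ((g ((k : ℝ) + 1 - 1) / ∏ j ∈ Finset.range b, ((k : ℝ) + 1 + 1 + j)) / ((k : ℝ) + 1)) := by
          refine Finset.sum_congr rfl fun k _ => ?_
          rw [Finset.prod_range_succ', div_div, add_sub_cancel_right]
          congr 3
          · refine Finset.prod_congr rfl fun j _ => ?_
            push_cast; ring
          · simp
      _ ≤ _ := e1
      _ ≤ (1 / (((n : ℝ) + 1) * p)) * ((1 / (((n + 1 : ℕ) : ℝ) * p) ^ b) * _) :=
          mul_le_mul_of_nonneg_left e2 (by positivity)
      _ ≤ _ := by
          rw [← mul_assoc]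
          exact mul_le_mul_of_nonneg_right e4 hS

lemma pow_exact (s u : ℝ) (h : 1 - u = s * u) (b : ℕ) :
    u ^ b = 1 - b * s + s ^ 2 * ∑ i ∈ Finset.range b, ∑ j ∈ Finset.range (i + 1), u ^ (j + 1) := by
  have geo : ∀ m : ℕ, 1 - u ^ m = s * ∑ j ∈ Finset.range m, u ^ (j + 1) := by
    intro m
    induction m with
    | zero => simp
    | succ m ih =>
      rw [Finset.sum_range_succ, mul_add, ← ih, pow_succ]
      linear_combination u ^ m * h
  induction b with
  | zero => simp
  | succ b ih =>
    rw [Finset.sum_range_succ, Nat.cast_add_one]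
    linear_combination ih + s * geo (b + 1) - u ^ b * h

lemma dbl_bound (u : ℝ) (hu : 0 < u) (b : ℕ) :
    ∑ i ∈ Finset.range b, ∑ j ∈ Finset.range (i + 1), u ^ (j + 1) ≤ (b : ℝ) ^ 2 * (1 + u ^ b) := by
  have key : ∀ j < b, u ^ (j + 1) ≤ 1 + u ^ b := by
    intro j hj
    rcases le_total u 1 with h | h
    · have := pow_le_one₀ hu.le h (n := j + 1)
      have : 0 < u ^ b := by positivity
      linarith
    · have := pow_le_pow_right₀ h (show j + 1 ≤ b by omega)
      linarith
  have hp : 0 ≤ 1 + u ^ b := by positivity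
  calc _ ≤ ∑ i ∈ Finset.range b, (b : ℝ) * (1 + u ^ b) := by
        refine Finset.sum_le_sum fun i hi => ?_
        rw [Finset.mem_range] at hi
        calc _ ≤ ∑ j ∈ Finset.range (i + 1), (1 + u ^ b) :=
              Finset.sum_le_sum fun j hj => key j (by rw [Finset.mem_range] at hj; omega)
          _ = ((i + 1 : ℕ) : ℝ) * (1 + u ^ b) := by simp; ring
          _ ≤ _ := by
              apply mul_le_mul_of_nonneg_right _ hp
              exact_mod_cast hi
    _ = _ := by simp; ring

lemma term_lower (m y : ℝ) (hm : 0 < m) (hy : 0 < y) (b : ℕ) :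
    1 / m ^ b - b / m ^ (b + 1) * (y - m) ≤ 1 / y ^ b := by
  have h := pow_exact ((y - m) / m) (m / y) (by field_simp) b
  have hS : 0 ≤ ∑ i ∈ Finset.range b, ∑ j ∈ Finset.range (i + 1), (m / y) ^ (j + 1) :=
    Finset.sum_nonneg fun i _ => Finset.sum_nonneg fun j _ => by positivity
  have h2 : 1 - b * ((y - m) / m) ≤ (m / y) ^ b := by
    rw [h]; have := mul_nonneg (sq_nonneg ((y - m) / m)) hS; linarith
  have h3 := mul_le_mul_of_nonneg_left h2 (show 0 ≤ 1 / m ^ b by positivity)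
  convert h3 using 1 <;> try rfl
  · rw [pow_succ]; field_simp
  · rw [div_pow]; field_simp

lemma term_upper (m y : ℝ) (hm : 0 < m) (hy : 0 < y) (b : ℕ) :
    1 / y ^ b ≤ 1 / m ^ b - b / m ^ (b + 1) * (y - m)
      + (b : ℝ) ^ 2 / m ^ (b + 2) * (y - m) ^ 2 + (b : ℝ) ^ 2 / m ^ 2 * ((y - m) ^ 2 / y ^ b) := by
  have h := pow_exact ((y - m) / m) (m / y) (by field_simp) b
  have hS := dbl_bound (m / y) (by positivity) b
  have h2 : (m / y) ^ b ≤ 1 - b * ((y - m) / m) +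
      ((y - m) / m) ^ 2 * ((b : ℝ) ^ 2 * (1 + (m / y) ^ b)) := by
    have := mul_le_mul_of_nonneg_left hS (sq_nonneg ((y - m) / m)); linarith
  have h3 := mul_le_mul_of_nonneg_left h2 (show 0 ≤ 1 / m ^ b by positivity)
  convert h3 using 1 <;> try rfl
  · rw [div_pow]; field_simp
  · rw [pow_succ, pow_add, div_pow m]; field_simp; ring

lemma prod_bound (a : ℝ) (ha : 0 < a) (b k : ℕ) :
    1 / (a + (k : ℝ)) ^ b ≤ (1 + b / a) ^ b * (1 / ∏ j ∈ Finset.range b, ((k : ℝ) + 1 + j)) := by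
  have hP : 0 < ∏ j ∈ Finset.range b, ((k : ℝ) + 1 + j) :=
    Finset.prod_pos fun j _ => by positivity
  have hy : 0 < a + (k : ℝ) := by positivity
  have : ∏ j ∈ Finset.range b, ((k : ℝ) + 1 + j) ≤ ((1 + b / a) * (a + k)) ^ b := by
    calc _ ≤ ∏ j ∈ Finset.range b, ((1 + b / a) * (a + (k : ℝ))) := by
          refine Finset.prod_le_prod (fun j _ => by positivity) fun j hj => ?_
          rw [Finset.mem_range] at hj
          have hj' : (j : ℝ) + 1 ≤ b := by exact_mod_cast hj
          have e : (1 + b / a) * (a + (k : ℝ)) = a + k + b + b / a * k := by field_simp; ring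
          have : 0 ≤ b / a * (k : ℝ) := by positivity
          linarith
      _ = _ := by simp
  rw [mul_one_div, div_le_div_iff₀ (by positivity) hP, one_mul, ← mul_pow]
  exact this

lemma weighted_var (n : ℕ) (hn : 0 < n) {p : ℝ} (h0 : 0 < p) (h1 : p < 1) (a : ℝ) (ha : 0 < a)
    (b : ℕ) (hmu : 1 ≤ (n : ℝ) * p) :
    ∑ k ∈ Finset.range (n + 1), binW n p k * (((k : ℝ) - n * p) ^ 2 / (a + k) ^ b)
      ≤ (1 + b / a) ^ b * (1 / ((n : ℝ) * p) ^ b) * ((2 + 2 * b + 2 * b ^ 2) * (n * p)) := by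
  have e := binW_multi h0 h1 b n hn (fun x => (x - n * p) ^ 2) (fun x => sq_nonneg _)
  have hb0 : (0 : ℝ) ≤ b := by positivity
  have f : ∑ k ∈ Finset.range (n + b + 1), binW (n + b) p k * ((k : ℝ) - b - n * p) ^ 2
      ≤ (2 + 2 * b + 2 * b ^ 2) * (n * p) := by
    have v := binW_var (n + b) p
    have s := binW_sum (n + b) p
    calc _ ≤ ∑ k ∈ Finset.range (n + b + 1),
          (2 * (binW (n + b) p k * ((k : ℝ) - ((n + b : ℕ) : ℝ) * p) ^ 2)
            + binW (n + b) p k * (2 * (b * (1 - p)) ^ 2)) := by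
          refine Finset.sum_le_sum fun k _ => ?_
          have : ((k : ℝ) - b - n * p) ^ 2 ≤
              2 * ((k : ℝ) - ((n + b : ℕ) : ℝ) * p) ^ 2 + 2 * (b * (1 - p)) ^ 2 := by
            push_cast
            nlinarith [sq_nonneg (((k : ℝ) - (n + b) * p) + b * (1 - p))]
          have := mul_le_mul_of_nonneg_left this (binW_nonneg (n + b) h0 h1 k)
          linarith
      _ = 2 * (((n + b : ℕ) : ℝ) * p * (1 - p)) + 2 * (b * (1 - p)) ^ 2 := by
          rw [Finset.sum_add_distrib, ← Finset.mul_sum, ← Finset.sum_mul, v, s, one_mul]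
      _ ≤ _ := by
          push_cast
          have q1 : ((n : ℝ) + b) * p * (1 - p) ≤ n * p + b := by
            have : ((n : ℝ) + b) * p * (1 - p) ≤ (n + b) * p * 1 := by gcongr; linarith
            nlinarith
          have q2 : ((b : ℝ) * (1 - p)) ^ 2 ≤ b ^ 2 := by
            apply pow_le_pow_left₀ (mul_nonneg hb0 (by linarith))
            nlinarith
          nlinarith [sq_nonneg (b : ℝ)]
  calc _ ≤ ∑ k ∈ Finset.range (n + 1), (1 + b / a) ^ b * (binW n p k *
          (((k : ℝ) - n * p) ^ 2 / ∏ j ∈ Finset.range b, ((k : ℝ) + 1 + j))) := by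
        refine Finset.sum_le_sum fun k _ => ?_
        have := mul_le_mul_of_nonneg_left (prod_bound a ha b k)
          (mul_nonneg (binW_nonneg n h0 h1 k) (sq_nonneg ((k : ℝ) - n * p)))
        calc _ = binW n p k * ((k : ℝ) - n * p) ^ 2 * (1 / (a + (k : ℝ)) ^ b) := by ring
          _ ≤ _ := this
          _ = _ := by ring
    _ ≤ (1 + b / a) ^ b * (1 / ((n : ℝ) * p) ^ b * ((2 + 2 * b + 2 * b ^ 2) * (n * p))) := by
        rw [← Finset.mul_sum]
        refine mul_le_mul_of_nonneg_left (e.trans ?_) (by positivity)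
        exact mul_le_mul_of_nonneg_left f (by positivity)
    _ = _ := by ring

/-- **Reciprocal moments of shifted binomials.** Let `X_n ~ Bin(n, p(n))` with `np → ∞`,
`a > 0` real and `b ≥ 1` an integer. Then
`1/(a+np)^b ≤ E[1/(a+X_n)^b] ≤ 1/(a+np)^b + O(1/(np)^(b+1))`, where the expectation is
written as an explicit sum over the binomial probability mass function. -/
theorem binomial_reciprocal_moment_bounds (p : ℕ → ℝ) (hp : ∀ n, 0 < p n ∧ p n < 1)
    (hnp : Tendsto (fun n : ℕ => (n : ℝ) * p n) atTop atTop)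
    (a : ℝ) (ha : 0 < a) (b : ℕ) (hb : 1 ≤ b) :
    (∀ n : ℕ,
        1 / (a + (n : ℝ) * p n) ^ b
          ≤ ∑ k ∈ Finset.range (n + 1),
              (n.choose k : ℝ) * (p n) ^ k * (1 - p n) ^ (n - k) * (1 / (a + (k : ℝ)) ^ b)) ∧
    (∃ C N : ℕ, ∀ n ≥ N,
        ∑ k ∈ Finset.range (n + 1),
            (n.choose k : ℝ) * (p n) ^ k * (1 - p n) ^ (n - k) * (1 / (a + (k : ℝ)) ^ b)
          ≤ 1 / (a + (n : ℝ) * p n) ^ b + (C : ℝ) / ((n : ℝ) * p n) ^ (b + 1)) := by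
  constructor
  · intro n
    obtain ⟨h0, h1⟩ := hp n
    have hm : 0 < a + (n : ℝ) * p n := by positivity
    change _ ≤ ∑ k ∈ Finset.range (n + 1), binW n (p n) k * (1 / (a + (k : ℝ)) ^ b)
    generalize p n = q at *
    calc 1 / (a + (n : ℝ) * q) ^ b = ∑ k ∈ Finset.range (n + 1),
          (binW n q k * (1 / (a + (n : ℝ) * q) ^ b)
            - b / (a + (n : ℝ) * q) ^ (b + 1) * (binW n q k * ((k : ℝ) - n * q))) := by
          rw [Finset.sum_sub_distrib, ← Finset.mul_sum, ← Finset.sum_mul, binW_mean, binW_sum]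
          ring
      _ ≤ _ := by
          refine Finset.sum_le_sum fun k _ => ?_
          have := mul_le_mul_of_nonneg_left (term_lower (a + (n : ℝ) * q) (a + k) hm
            (by positivity) b) (binW_nonneg n h0 h1 k)
          refine le_trans (le_of_eq ?_) this
          ring
  · set K : ℝ := (b : ℝ) ^ 2 * (1 + (1 + b / a) ^ b * (2 + 2 * b + 2 * b ^ 2)) with hK
    obtain ⟨N, hN⟩ := eventually_atTop.1 (hnp.eventually_ge_atTop 1)
    refine ⟨⌈K⌉₊, N, fun n hn => ?_⟩
    have hmu := hN n hn
    obtain ⟨h0, h1⟩ := hp n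
    have hn0 : 0 < n := by
      rcases Nat.eq_zero_or_pos n with h | h
      · subst h; norm_num at hmu
      · exact h
    change ∑ k ∈ Finset.range (n + 1), binW n (p n) k * (1 / (a + (k : ℝ)) ^ b) ≤ _
    generalize p n = q at *
    have hm : 0 < a + (n : ℝ) * q := by positivity
    have W := weighted_var n hn0 h0 h1 a ha b hmu
    have V := binW_var n q
    have V' : (n : ℝ) * q * (1 - q) ≤ n * q := by nlinarith
    have hmm : (n : ℝ) * q ≤ a + n * q := by linarith
    generalize hμ : (n : ℝ) * q = μ at *
    have hμ0 : 0 < μ := by linarith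
    calc _ ≤ ∑ k ∈ Finset.range (n + 1),
          (binW n q k * (1 / (a + μ) ^ b)
            - b / (a + μ) ^ (b + 1) * (binW n q k * ((k : ℝ) - μ))
            + (b : ℝ) ^ 2 / (a + μ) ^ (b + 2) * (binW n q k * ((k : ℝ) - μ) ^ 2)
            + (b : ℝ) ^ 2 / (a + μ) ^ 2 * (binW n q k * (((k : ℝ) - μ) ^ 2 / (a + k) ^ b))) := by
          refine Finset.sum_le_sum fun k _ => ?_
          have := mul_le_mul_of_nonneg_left (term_upper (a + μ) (a + k) hm
            (by positivity) b) (binW_nonneg n h0 h1 k)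
          refine le_trans this (le_of_eq ?_)
          rw [add_sub_add_left_eq_sub]
          ring
      _ = 1 / (a + μ) ^ b + ((b : ℝ) ^ 2 / (a + μ) ^ (b + 2) * (μ * (1 - q))
            + (b : ℝ) ^ 2 / (a + μ) ^ 2 * ∑ k ∈ Finset.range (n + 1),
              (binW n q k * (((k : ℝ) - μ) ^ 2 / (a + k) ^ b))) := by
          rw [Finset.sum_add_distrib, Finset.sum_add_distrib, Finset.sum_sub_distrib,
            ← Finset.mul_sum, ← Finset.mul_sum, ← Finset.mul_sum, ← Finset.sum_mul, V, binW_sum,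
            ← hμ, binW_mean]
          ring
      _ ≤ 1 / (a + μ) ^ b + ((b : ℝ) ^ 2 / μ ^ (b + 2) * μ
            + (b : ℝ) ^ 2 / μ ^ 2 *
              ((1 + b / a) ^ b * (1 / μ ^ b) * ((2 + 2 * b + 2 * b ^ 2) * μ))) := by
          have hS : 0 ≤ ∑ k ∈ Finset.range (n + 1),
              binW n q k * (((k : ℝ) - μ) ^ 2 / (a + k) ^ b) :=
            Finset.sum_nonneg fun k _ => mul_nonneg (binW_nonneg _ h0 h1 _) (by positivity)
          gcongr
      _ = 1 / (a + μ) ^ b + K / μ ^ (b + 1) := by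
          rw [hK, pow_succ μ b, pow_add μ b 2]
          congr 1
          generalize (1 + (b : ℝ) / a) ^ b = L
          field_simp
      _ ≤ _ := by
          gcongr
          exact Nat.le_ceil K
end
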